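/- arXiv:2511.19698 — 2 statements merged into one kernel-verified Lean document; each statement's English description precedes it below -/
import Mathlib

section
/- For every integer n ≥ 2 and every nonnegative integer k, the number of partitions of n with even mex and exactly k parts greater than 1 equals the number of partitions of n with positive crank and exactly k+1 parts greater than 1. -/
open scoped Classical

/-- The parts of a partition, sorted in nonincreasing order, so that
`(sortedParts p).getD (i-1) 0` is the `i`-th part `λ_i` (1-indexed). -/
def sortedParts {n : ℕ} (p : n.Partition) : List ℕ :=
  p.parts.sort (· ≥ ·)

/-- The mex of a partition: the smallest positive integer that is not a part. -/
noncomputable def mex {n : ℕ} (p : n.Partition) : ℕ :=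
  sInf {m : ℕ | 0 < m ∧ m ∉ p.parts}

/-- A partition has a fixed point if `λ_i = i` for some index `i`. -/
def hasFixedPoint {n : ℕ} (p : n.Partition) : Prop :=
  ∃ i : ℕ, 0 < i ∧ i ≤ (sortedParts p).length ∧ (sortedParts p).getD (i - 1) 0 = i

/-- `ω(λ)`: the number of parts equal to 1. -/
def omegaStat {n : ℕ} (p : n.Partition) : ℕ := p.parts.count 1

/-- `μ(λ)`: the number of parts greater than `ω(λ)`. -/
def muStat {n : ℕ} (p : n.Partition) : ℕ :=
  (p.parts.filter (fun x => omegaStat p < x)).card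

/-- The crank of a partition. -/
def crank {n : ℕ} (p : n.Partition) : ℤ :=
  if omegaStat p = 0 then (p.parts.sup : ℤ) else (muStat p : ℤ) - (omegaStat p : ℤ)

/-- `β(λ)`: the number of parts greater than 1. -/
def betaStat {n : ℕ} (p : n.Partition) : ℕ :=
  (p.parts.filter (fun x => 1 < x)).card

/-- The Durfee square size: the largest `i` with `λ_i ≥ i` (0 if none). -/
noncomputable def durfee {n : ℕ} (p : n.Partition) : ℕ :=
  sSup {i : ℕ | 0 < i ∧ i ≤ (sortedParts p).length ∧ i ≤ (sortedParts p).getD (i - 1) 0}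

/-- Pairs: number of ones and the multiset of parts greater than one. -/
def Pr (n k : ℕ) : Set (ℕ × Multiset ℕ) :=
  {p | (∀ x ∈ p.2, 2 ≤ x) ∧ p.2.card = k ∧ p.1 + p.2.sum = n}

def CC (m n k : ℕ) : Set (ℕ × Multiset ℕ) :=
  {p | p ∈ Pr n k ∧ (p.2.filter (fun x => p.1 < x)).card + m < p.1}

def FF (m n k : ℕ) : Set (ℕ × Multiset ℕ) :=
  {p | p ∈ Pr n k ∧ p.1 < (p.2.filter (fun x => p.1 + m < x)).card}

def TT (m n k : ℕ) : Set (Multiset ℕ × ℕ × Multiset ℕ) :=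
  {t | (∀ a ∈ t.1, t.2.1 ≤ a) ∧ (∀ b ∈ t.2.2, 2 ≤ b ∧ b ≤ t.2.1) ∧ 2 ≤ t.2.1 ∧
    t.1.card + m < t.2.1 ∧ t.1.card + t.2.2.card = k ∧
    t.1.card + t.1.sum + t.2.1 + t.2.2.sum = n}

noncomputable def pmex (p : ℕ × Multiset ℕ) : ℕ :=
  sInf {m : ℕ | 0 < m ∧ m ∉ Multiset.replicate p.1 1 + p.2}

def EE (j n k : ℕ) : Set (ℕ × Multiset ℕ) :=
  {p | p ∈ Pr n k ∧ j < pmex p ∧ Even (pmex p + j)}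

def DD (j n k : ℕ) : Set (ℕ × Multiset ℕ) :=
  {p | p ∈ Pr n k ∧ j < pmex p}

def tri : ℕ → ℕ
  | 0 => 0
  | (j + 1) => tri j + (j + 1)

def stair (j : ℕ) : Multiset ℕ := (Multiset.range j).map (fun i => i + 2)

theorem stair_sum (j : ℕ) : (stair j).sum + 1 = tri (j + 1) := by
  induction j with
  | zero => simp [stair, tri]
  | succ j ih =>
    rw [tri, ← ih]
    simp [stair, Multiset.range_succ]
    omega

theorem stair_card (j : ℕ) : (stair j).card = j := by simp [stair]

theorem stair_le (j : ℕ) (s : Multiset ℕ) : stair j ≤ s ↔ ∀ i, 2 ≤ i → i ≤ j + 1 → i ∈ s := by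
  have hn : (stair j).Nodup := by
    apply Multiset.Nodup.map _ (Multiset.nodup_range j)
    intro a b h
    simpa using h
  rw [Multiset.le_iff_subset hn]
  constructor
  · intro h i h1 h2
    apply h
    simp only [stair, Multiset.mem_map, Multiset.mem_range]
    exact ⟨i - 2, by omega, by omega⟩
  · intro h x hx
    simp only [stair, Multiset.mem_map, Multiset.mem_range] at hx
    obtain ⟨i, hi, rfl⟩ := hx
    exact h _ (by omega) (by omega)

/-- The partition attached to a pair. -/
def toPart (n : ℕ) (p : ℕ × Multiset ℕ) (h1 : ∀ x ∈ p.2, 2 ≤ x) (h2 : p.1 + p.2.sum = n) :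
    n.Partition where
  parts := Multiset.replicate p.1 1 + p.2
  parts_pos := by
    intro i hi
    rw [Multiset.mem_add] at hi
    rcases hi with hi | hi
    · rw [Multiset.eq_of_mem_replicate hi]; exact Nat.one_pos
    · exact lt_of_lt_of_le (by norm_num) (h1 i hi)
  parts_sum := by simp [h2]

noncomputable def ofPart {n : ℕ} (q : n.Partition) : ℕ × Multiset ℕ :=
  (q.parts.count 1, q.parts.filter (fun x => 1 < x))

theorem parts_split {n : ℕ} (q : n.Partition) :
    Multiset.replicate (ofPart q).1 1 + (ofPart q).2 = q.parts := by
  have h := Multiset.filter_add_not (fun x => 1 < x) q.parts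
  have h2 : q.parts.filter (fun x => ¬ 1 < x) = Multiset.replicate (q.parts.count 1) 1 := by
    rw [← Multiset.filter_eq']
    apply Multiset.filter_congr
    intro x hx
    have := q.parts_pos hx
    omega
  rw [h2, add_comm] at h
  exact h

theorem ofPart_inj (n : ℕ) : Function.Injective (ofPart (n := n)) := by
  intro q q' h
  apply Nat.Partition.ext
  rw [← parts_split q, ← parts_split q', h]

theorem ofPart_mem {n : ℕ} (q : n.Partition) : ofPart q ∈ Pr n (betaStat q) := by
  refine ⟨?_, ?_, ?_⟩
  · intro x hx
    exact (Multiset.mem_filter.1 hx).2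
  · rfl
  · have := congrArg Multiset.sum (parts_split q)
    rw [q.parts_sum] at this
    simpa using this

theorem exists_ofPart {n k : ℕ} (p : ℕ × Multiset ℕ) (hp : p ∈ Pr n k) :
    ∃ q : n.Partition, ofPart q = p ∧ betaStat q = k := by
  obtain ⟨h1, h2, h3⟩ := hp
  have hc : p.2.count 1 = 0 := by
    rw [Multiset.count_eq_zero]
    intro h
    have := h1 1 h
    omega
  have hf : p.2.filter (fun x => 1 < x) = p.2 := by
    rw [Multiset.filter_eq_self]
    intro a ha
    exact h1 a ha
  have hr : (Multiset.replicate p.1 1).filter (fun x => 1 < x) = 0 := by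
    rw [Multiset.filter_eq_nil]
    intro a ha
    rw [Multiset.eq_of_mem_replicate ha]
    omega
  have key : ofPart (toPart n p h1 h3) = p := by
    apply Prod.ext
    · simp [ofPart, toPart, hc]
    · simp only [ofPart, toPart, Multiset.filter_add, hf, hr, zero_add]
  refine ⟨toPart n p h1 h3, key, ?_⟩
  have := (ofPart_mem (toPart n p h1 h3)).2.1
  rw [← this, key, h2]

theorem Pr_finite (n k : ℕ) : (Pr n k).Finite := by
  apply (Set.finite_range (ofPart (n := n))).subset
  intro p hp
  obtain ⟨q, hq, _⟩ := exists_ofPart p hp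
  exact ⟨q, hq⟩

theorem pmex_ofPart {n : ℕ} (q : n.Partition) : pmex (ofPart q) = mex q := by
  rw [pmex, mex, parts_split]

theorem even_count (n k : ℕ) :
    {q : Nat.Partition n | Even (mex q) ∧ betaStat q = k}.ncard = (EE 0 n k).ncard := by
  rw [← Set.ncard_image_of_injective _ (ofPart_inj n)]
  congr 1
  ext p
  constructor
  · rintro ⟨q, ⟨h1, h2⟩, rfl⟩
    refine ⟨h2 ▸ ofPart_mem q, ?_, ?_⟩
    · have hne : {m : ℕ | 0 < m ∧ m ∉ q.parts}.Nonempty := by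
        refine ⟨n + 1, Nat.succ_pos _, ?_⟩
        intro h
        have := Multiset.le_sum_of_mem h
        rw [q.parts_sum] at this
        omega
      rw [pmex_ofPart]
      exact (Nat.sInf_mem hne).1
    · simpa [pmex_ofPart] using h1
  · rintro ⟨h1, h2, h3⟩
    obtain ⟨q, rfl, hq⟩ := exists_ofPart p h1
    exact ⟨q, ⟨by simpa [pmex_ofPart] using h3, hq⟩, rfl⟩

theorem crank_iff {n k : ℕ} (q : n.Partition) (hk : betaStat q = k + 1) :
    0 < crank q ↔ (ofPart q).1 < ((ofPart q).2.filter (fun x => (ofPart q).1 + 0 < x)).card := by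
  have hm : muStat q = ((ofPart q).2.filter (fun x => (ofPart q).1 + 0 < x)).card := by
    have hs := parts_split q
    have hw : omegaStat q = (ofPart q).1 := rfl
    rw [muStat, hw]
    conv_lhs => rw [← hs]
    rw [Multiset.filter_add, Multiset.card_add, Nat.add_zero]
    have : (Multiset.replicate (ofPart q).1 1).filter (fun x => (ofPart q).1 < x) = 0 := by
      rw [Multiset.filter_eq_nil]
      intro a ha
      have h1 := Multiset.eq_of_mem_replicate ha
      have h2 := Multiset.card_pos_iff_exists_mem.2 ⟨a, ha⟩
      rw [Multiset.card_replicate] at h2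
      omega
    rw [this, Multiset.card_zero, zero_add]
  rw [← hm]
  have hw : (ofPart q).1 = omegaStat q := rfl
  rw [hw, crank]
  by_cases h0 : omegaStat q = 0
  · rw [if_pos h0]
    have hpos : 0 < (q.parts.filter (fun x => 1 < x)).card := by
      have : (q.parts.filter (fun x => 1 < x)).card = k + 1 := hk
      omega
    obtain ⟨x, hx⟩ := Multiset.card_pos_iff_exists_mem.1 hpos
    rw [Multiset.mem_filter] at hx
    have h1 : x ≤ q.parts.sup := Multiset.le_sup hx.1
    have h2 : 0 < muStat q := by
      rw [muStat]
      apply Multiset.card_pos_iff_exists_mem.2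
      refine ⟨x, ?_⟩
      rw [Multiset.mem_filter]
      exact ⟨hx.1, by omega⟩
    constructor <;> intro _ <;> omega
  · rw [if_neg h0]
    omega

theorem crank_count (n k : ℕ) :
    {q : Nat.Partition n | 0 < crank q ∧ betaStat q = k + 1}.ncard = (FF 0 n (k + 1)).ncard := by
  rw [← Set.ncard_image_of_injective _ (ofPart_inj n)]
  congr 1
  ext p
  constructor
  · rintro ⟨q, ⟨h1, h2⟩, rfl⟩
    exact ⟨h2 ▸ ofPart_mem q, (crank_iff q h2).1 h1⟩
  · rintro ⟨h1, h2⟩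
    obtain ⟨q, rfl, hq⟩ := exists_ofPart p h1
    exact ⟨q, ⟨(crank_iff q hq).2 h2, hq⟩, rfl⟩

theorem CC_add_FF (m r k : ℕ) :
    (CC m (r + m + 1) k).ncard + (FF (m + 1) r k).ncard = (Pr r k).ncard := by
  have hsub : FF (m + 1) r k ⊆ Pr r k := fun p hp => hp.1
  rw [← Set.ncard_diff_add_ncard_of_subset hsub (Pr_finite r k)]
  congr 1
  have hinj : Function.Injective (fun p : ℕ × Multiset ℕ => (p.1 + (m + 1), p.2)) := by
    rintro ⟨a, b⟩ ⟨c, d⟩ h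
    simp only [Prod.mk.injEq] at h ⊢
    exact ⟨by omega, h.2⟩
  rw [← Set.ncard_image_of_injective (Pr r k \ FF (m + 1) r k) hinj]
  congr 1
  ext ⟨w, s⟩
  constructor
  · rintro ⟨⟨h1, h2, h3⟩, h4⟩
    simp only at h1 h2 h3 h4
    refine ⟨(w - (m + 1), s), ⟨⟨h1, h2, ?_⟩, ?_⟩, ?_⟩
    · simp only; omega
    · rintro ⟨_, h5⟩
      simp only at h5
      rw [show w - (m + 1) + (m + 1) = w by omega] at h5
      omega
    · simp only [Prod.mk.injEq, and_true]; omega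
  · rintro ⟨⟨w', s'⟩, ⟨⟨h1, h2, h3⟩, h4⟩, h5⟩
    simp only [Prod.mk.injEq] at h5
    obtain ⟨rfl, rfl⟩ := h5
    simp only at h1 h2 h3
    refine ⟨⟨h1, h2, ?_⟩, ?_⟩
    · simp only; omega
    · by_contra h6
      apply h4
      refine ⟨⟨h1, h2, h3⟩, ?_⟩
      simp only at h6 ⊢
      omega

theorem TT_CC (m n k : ℕ) (h : 1 ≤ m ∨ 2 ≤ n) : (TT m n k).ncard = (CC m n k).ncard := by
  have hfilt : ∀ (A B : Multiset ℕ) (x : ℕ), (∀ a ∈ A, x ≤ a) → (∀ b ∈ B, b ≤ x) →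
      (A.map (· + 1) + B).filter (fun y => x < y) = A.map (· + 1) ∧
      (A.map (· + 1) + B).filter (fun y => ¬ x < y) = B := by
    intro A B x hA hB
    have h1 : (A.map (· + 1)).filter (fun y => x < y) = A.map (· + 1) := by
      rw [Multiset.filter_eq_self]
      intro a ha
      obtain ⟨b, hb, rfl⟩ := Multiset.mem_map.1 ha
      have := hA b hb
      omega
    have h2 : (A.map (· + 1)).filter (fun y => ¬ x < y) = 0 := by
      rw [Multiset.filter_eq_nil]
      intro a ha
      obtain ⟨b, hb, rfl⟩ := Multiset.mem_map.1 ha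
      have := hA b hb
      omega
    have h3 : B.filter (fun y => x < y) = 0 := by
      rw [Multiset.filter_eq_nil]
      intro a ha
      have := hB a ha
      omega
    have h4 : B.filter (fun y => ¬ x < y) = B := by
      rw [Multiset.filter_eq_self]
      intro a ha
      have := hB a ha
      omega
    rw [Multiset.filter_add, Multiset.filter_add, h1, h2, h3, h4]
    simp
  have hinj : Set.InjOn (fun t : Multiset ℕ × ℕ × Multiset ℕ => (t.2.1, t.1.map (· + 1) + t.2.2))
      (TT m n k) := by
    rintro ⟨A, x, B⟩ ⟨h1, h2, -⟩ ⟨A', x', B'⟩ ⟨h1', h2', -⟩ heq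
    simp only [Prod.mk.injEq] at heq h1 h2 h1' h2'
    obtain ⟨rfl, heq⟩ := heq
    have e := hfilt A B x h1 (fun b hb => (h2 b hb).2)
    have e' := hfilt A' B' x h1' (fun b hb => (h2' b hb).2)
    rw [← heq] at e'
    have hA : A.map (· + 1) = A'.map (· + 1) := e.1.symm.trans e'.1
    have hB : B = B' := e.2.symm.trans e'.2
    have hA' : A = A' := Multiset.map_injective (add_left_injective 1) hA
    rw [hA', hB]
  rw [← Set.ncard_image_of_injOn hinj]
  congr 1
  ext ⟨w, s⟩
  constructor
  · rintro ⟨⟨A, x, B⟩, ⟨h1, h2, h3, h4, h5, h6⟩, heq⟩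
    simp only [Prod.mk.injEq] at heq h1 h2 h3 h4 h5 h6
    obtain ⟨rfl, rfl⟩ := heq
    have e := hfilt A B x h1 (fun b hb => (h2 b hb).2)
    refine ⟨⟨?_, ?_, ?_⟩, ?_⟩
    · intro y hy
      rcases Multiset.mem_add.1 hy with hy | hy
      · obtain ⟨b, hb, rfl⟩ := Multiset.mem_map.1 hy
        have := h1 b hb
        omega
      · exact (h2 y hy).1
    · simp only [Multiset.card_add, Multiset.card_map]; omega
    · simp only [Multiset.sum_add, Multiset.sum_map_add, Multiset.map_id', Multiset.map_const',
        Multiset.sum_replicate, smul_eq_mul, mul_one]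
      omega
    · simp only
      rw [e.1, Multiset.card_map]
      exact h4
  · rintro ⟨⟨h1, h2, h3⟩, h4⟩
    simp only at h1 h2 h3 h4
    have hsplit := Multiset.filter_add_not (fun y => w < y) s
    have hmap : ((s.filter (fun y => w < y)).map (· - 1)).map (· + 1)
        = s.filter (fun y => w < y) := by
      rw [Multiset.map_map]
      conv_rhs => rw [← Multiset.map_id (s.filter (fun y => w < y))]
      apply Multiset.map_congr rfl
      intro y hy
      have := (Multiset.mem_filter.1 hy).2
      simp only [Function.comp, id]
      omega
    have hsum : ((s.filter (fun y => w < y)).map (· - 1)).sum + (s.filter (fun y => w < y)).card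
        = (s.filter (fun y => w < y)).sum := by
      conv_rhs => rw [← hmap]
      simp only [Multiset.sum_map_add, Multiset.map_id', Multiset.map_const',
        Multiset.sum_replicate, smul_eq_mul, mul_one, Multiset.card_map]
    have hs := congrArg Multiset.sum hsplit
    have hc := congrArg Multiset.card hsplit
    rw [Multiset.sum_add] at hs
    rw [Multiset.card_add] at hc
    have hw : 2 ≤ w := by
      by_contra hlt
      have hw1 : w = 1 := by omega
      have hm : m = 0 := by omega
      have hf : (s.filter (fun y => w < y)) = s := by
        rw [Multiset.filter_eq_self]
        intro y hy
        have := h1 y hy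
        omega
      rw [hf] at h4
      have : s = 0 := Multiset.card_eq_zero.1 (by omega)
      subst this
      simp at h3
      omega
    refine ⟨((s.filter (fun y => w < y)).map (· - 1), w, s.filter (fun y => ¬ w < y)),
      ⟨?_, ?_, hw, ?_, ?_, ?_⟩, ?_⟩
    · intro a ha
      obtain ⟨b, hb, rfl⟩ := Multiset.mem_map.1 ha
      have := (Multiset.mem_filter.1 hb).2
      simp only
      omega
    · intro b hb
      have := Multiset.mem_filter.1 hb
      exact ⟨h1 b this.1, by simpa using this.2⟩
    · simp only [Multiset.card_map]; exact h4
    · simp only [Multiset.card_map]; omega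
    · simp only [Multiset.card_map]; omega
    · simp only [hmap, hsplit]

theorem TT_unique_x {A B A' B' : Multiset ℕ} {x x' : ℕ} (hc : A.card = A'.card)
    (hB : ∀ b ∈ B, b ≤ x) (hA' : ∀ a ∈ A', x' ≤ a)
    (heq : A + {x} + B = A' + {x'} + B') : x' ≤ x := by
  by_contra hlt
  have h1 : ((A + {x} + B).filter (fun y => x' ≤ y)).card ≤ A.card := by
    have hx : ({x} : Multiset ℕ).filter (fun y => x' ≤ y) = 0 := by
      rw [Multiset.filter_eq_nil]
      intro a ha
      rw [Multiset.mem_singleton.1 ha]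
      exact hlt
    have hb : B.filter (fun y => x' ≤ y) = 0 := by
      rw [Multiset.filter_eq_nil]
      intro a ha
      have := hB a ha
      omega
    rw [Multiset.filter_add, Multiset.filter_add, hx, hb, add_zero, add_zero]
    exact Multiset.card_le_card (Multiset.filter_le _ _)
  have h2 : A'.card + 1 ≤ ((A' + {x'} + B').filter (fun y => x' ≤ y)).card := by
    have ha : (A' + {x'}).filter (fun y => x' ≤ y) = A' + {x'} := by
      rw [Multiset.filter_eq_self]
      intro a ha
      rcases Multiset.mem_add.1 ha with ha | ha
      · exact hA' a ha
      · rw [Multiset.mem_singleton.1 ha]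
    rw [Multiset.filter_add, ha]
    simp
  rw [heq] at h1
  omega

theorem TT_unique_A {A B A' B' : Multiset ℕ} {x : ℕ} (hc : A.card = A'.card)
    (hA : ∀ a ∈ A, x ≤ a) (hB : ∀ b ∈ B, b ≤ x)
    (hA' : ∀ a ∈ A', x ≤ a) (hB' : ∀ b ∈ B', b ≤ x)
    (heq : A + B = A' + B') : A = A' := by
  have gen : ∀ (A B : Multiset ℕ), (∀ a ∈ A, x ≤ a) → (∀ b ∈ B, b ≤ x) →
      A = (A + B).filter (fun y => x < y) +
        Multiset.replicate (A.card - ((A + B).filter (fun y => x < y)).card) x := by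
    intro A B hA hB
    have hb : B.filter (fun y => x < y) = 0 := by
      rw [Multiset.filter_eq_nil]
      intro a ha
      have := hB a ha
      omega
    rw [Multiset.filter_add, hb, add_zero]
    have hs := Multiset.filter_add_not (fun y => x < y) A
    have hr : A.filter (fun y => ¬ x < y)
        = Multiset.replicate (A.filter (fun y => ¬ x < y)).card x := by
      rw [Multiset.eq_replicate]
      refine ⟨rfl, ?_⟩
      intro b hb
      have h1 := Multiset.mem_filter.1 hb
      have := hA b h1.1
      have := h1.2
      omega
    have hcard := congrArg Multiset.card hs
    rw [Multiset.card_add] at hcard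
    rw [show A.card - (A.filter (fun y => x < y)).card
      = (A.filter (fun y => ¬ x < y)).card by omega, ← hr, hs]
  rw [gen A B hA hB, gen A' B' hA' hB', heq, hc]

theorem list_split (m : ℕ) (s : Multiset ℕ) (w : ℕ)
    (h : w < (s.filter (fun y => w + m < y)).card) :
    ∃ (A : Multiset ℕ) (x : ℕ) (B : Multiset ℕ), s = A + {x} + B ∧ A.card = w ∧
      (∀ a ∈ A, x ≤ a) ∧ (∀ b ∈ B, b ≤ x) ∧ w + m < x := by
  have hw : w < s.card := lt_of_lt_of_le h (Multiset.card_le_card (Multiset.filter_le _ _))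
  obtain ⟨l, hl, hp⟩ : ∃ l : List ℕ, (l : Multiset ℕ) = s ∧ l.Pairwise (· ≥ ·) :=
    ⟨s.sort (· ≥ ·), Multiset.sort_eq _ _, Multiset.pairwise_sort _ _⟩
  have hlen : w < l.length := by rw [← hl] at hw; simpa using hw
  have hdec : l = l.take w ++ l[w] :: l.drop (w + 1) := by
    rw [← List.drop_eq_getElem_cons hlen, List.take_append_drop]
  have hp' := hp
  rw [hdec, List.pairwise_append, List.pairwise_cons] at hp'
  obtain ⟨-, ⟨hq1, -⟩, hq2⟩ := hp'
  have hs : s = (l.take w : Multiset ℕ) + {l[w]} + (l.drop (w + 1) : Multiset ℕ) := by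
    rw [← hl]
    conv_lhs => rw [hdec]
    rw [← Multiset.coe_add, ← Multiset.cons_coe, ← Multiset.singleton_add, add_assoc]
  have hA : ∀ a ∈ (l.take w : Multiset ℕ), l[w] ≤ a := by
    intro a ha
    exact hq2 a (by simpa using ha) _ List.mem_cons_self
  have hB : ∀ b ∈ (l.drop (w + 1) : Multiset ℕ), b ≤ l[w] := by
    intro b hb
    exact hq1 b (by simpa using hb)
  have hcard : (l.take w : Multiset ℕ).card = w := by
    rw [Multiset.coe_card, List.length_take]
    omega
  refine ⟨_, _, _, hs, hcard, hA, hB, ?_⟩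
  by_contra hlt
  have hx : ({l[w]} : Multiset ℕ).filter (fun y => w + m < y) = 0 := by
    rw [Multiset.filter_eq_nil]
    intro a ha
    rw [Multiset.mem_singleton.1 ha]
    exact hlt
  have hb : (l.drop (w + 1) : Multiset ℕ).filter (fun y => w + m < y) = 0 := by
    rw [Multiset.filter_eq_nil]
    intro a ha
    have := hB a ha
    omega
  rw [hs, Multiset.filter_add, Multiset.filter_add, hx, hb, add_zero, add_zero] at h
  have := Multiset.card_le_card (Multiset.filter_le (fun y => w + m < y) (l.take w : Multiset ℕ))
  omega

theorem TT_FF (m n k : ℕ) : (TT m n k).ncard = (FF m n (k + 1)).ncard := by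
  have hinj : Set.InjOn (fun t : Multiset ℕ × ℕ × Multiset ℕ => (t.1.card, t.1 + {t.2.1} + t.2.2))
      (TT m n k) := by
    rintro ⟨A, x, B⟩ ⟨h1, h2, -⟩ ⟨A', x', B'⟩ ⟨h1', h2', -⟩ heq
    simp only [Prod.mk.injEq] at heq h1 h2 h1' h2'
    obtain ⟨hc, heq⟩ := heq
    have e1 := TT_unique_x hc (fun b hb => (h2 b hb).2) h1' heq
    have e2 := TT_unique_x hc.symm (fun b hb => (h2' b hb).2) h1 heq.symm
    have e : x = x' := le_antisymm e2 e1
    subst e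
    have heq' : A + B = A' + B' := by
      rw [add_right_comm A, add_right_comm A'] at heq
      exact add_right_cancel heq
    have hA := TT_unique_A hc h1 (fun b hb => (h2 b hb).2) h1' (fun b hb => (h2' b hb).2) heq'
    subst hA
    rw [add_left_cancel heq']
  rw [← Set.ncard_image_of_injOn hinj]
  congr 1
  ext ⟨w, s⟩
  constructor
  · rintro ⟨⟨A, x, B⟩, ⟨h1, h2, h3, h4, h5, h6⟩, heq⟩
    simp only [Prod.mk.injEq] at heq h1 h2 h3 h4 h5 h6
    obtain ⟨rfl, rfl⟩ := heq
    refine ⟨⟨?_, ?_, ?_⟩, ?_⟩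
    · intro y hy
      rcases Multiset.mem_add.1 hy with hy | hy
      · rcases Multiset.mem_add.1 hy with hy | hy
        · exact h3.trans (h1 y hy)
        · rw [Multiset.mem_singleton.1 hy]; exact h3
      · exact (h2 y hy).1
    · simp only [Multiset.card_add, Multiset.card_singleton]; omega
    · simp only [Multiset.sum_add, Multiset.sum_singleton]; omega
    · simp only
      have ha : (A + {x}).filter (fun y => A.card + m < y) = A + {x} := by
        rw [Multiset.filter_eq_self]
        intro a ha
        rcases Multiset.mem_add.1 ha with ha | ha
        · exact lt_of_lt_of_le h4 (h1 a ha)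
        · rw [Multiset.mem_singleton.1 ha]; exact h4
      rw [Multiset.filter_add, ha]
      simp only [Multiset.card_add, Multiset.card_singleton]; omega
  · rintro ⟨⟨h1, h2, h3⟩, h4⟩
    simp only at h1 h2 h3 h4
    obtain ⟨A, x, B, rfl, rfl, hA, hB, hx⟩ := list_split m s w h4
    simp only [Multiset.card_add, Multiset.card_singleton, Multiset.sum_add,
      Multiset.sum_singleton] at h2 h3
    refine ⟨(A, x, B), ⟨hA, ?_, ?_, hx, ?_, ?_⟩, rfl⟩
    · intro b hb
      exact ⟨h1 b (by simp [hb]), hB b hb⟩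
    · exact h1 x (by simp)
    · simp only; omega
    · simp only; omega

theorem lt_pmex_iff {n k : ℕ} (p : ℕ × Multiset ℕ) (hp : p ∈ Pr n k) (j : ℕ) :
    j + 1 < pmex p ↔ 0 < p.1 ∧ stair j ≤ p.2 := by
  have hne : {m : ℕ | 0 < m ∧ m ∉ Multiset.replicate p.1 1 + p.2}.Nonempty := by
    refine ⟨n + 1, Nat.succ_pos _, ?_⟩
    intro h
    have := Multiset.le_sum_of_mem h
    have h3 := hp.2.2
    simp at this
    omega
  rw [stair_le]
  constructor
  · intro h
    have hall : ∀ i, 0 < i → i ≤ j + 1 → i ∈ Multiset.replicate p.1 1 + p.2 := by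
      intro i h0 hi
      by_contra hni
      have := Nat.sInf_le (s := {m : ℕ | 0 < m ∧ m ∉ Multiset.replicate p.1 1 + p.2}) ⟨h0, hni⟩
      rw [pmex] at h
      omega
    constructor
    · rcases Multiset.mem_add.1 (hall 1 (by omega) (by omega)) with h1 | h1
      · have := Multiset.card_pos_iff_exists_mem.2 ⟨_, h1⟩
        simpa using this
      · have := hp.1 1 h1
        omega
    · intro i h2 hi
      rcases Multiset.mem_add.1 (hall i (by omega) hi) with h1 | h1
      · have := Multiset.eq_of_mem_replicate h1
        omega
      · exact h1
  · rintro ⟨h1, h2⟩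
    by_contra hlt
    obtain ⟨h3, h4⟩ := Nat.sInf_mem hne
    rw [← pmex] at h3 h4
    apply h4
    rw [Multiset.mem_add]
    by_cases h5 : pmex p = 1
    · left
      rw [h5, Multiset.mem_replicate]
      exact ⟨by omega, rfl⟩
    · right
      exact h2 _ (by omega) (by omega)

theorem DD_card (j r k : ℕ) : (DD (j + 1) (r + tri (j + 1)) (k + j)).ncard = (Pr r k).ncard := by
  have hinj : Function.Injective (fun p : ℕ × Multiset ℕ => (p.1 + 1, p.2 + stair j)) := by
    rintro ⟨a, b⟩ ⟨c, d⟩ h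
    simp only [Prod.mk.injEq] at h ⊢
    exact ⟨by omega, add_right_cancel h.2⟩
  rw [← Set.ncard_image_of_injective (Pr r k) hinj]
  congr 1
  have ht := stair_sum j
  have hc := stair_card j
  ext ⟨w, s⟩
  constructor
  · rintro ⟨hp, h⟩
    rw [lt_pmex_iff _ hp] at h
    obtain ⟨h1, h2, h3⟩ := hp
    obtain ⟨h4, h5⟩ := h
    obtain ⟨u, rfl⟩ := Multiset.le_iff_exists_add.1 h5
    simp only [Multiset.card_add, Multiset.sum_add] at h1 h2 h3 h4
    refine ⟨(w - 1, u), ⟨?_, ?_, ?_⟩, ?_⟩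
    · intro x hx
      exact h1 x (Multiset.mem_add.2 (Or.inr hx))
    · simp only; omega
    · simp only; omega
    · simp only [Prod.mk.injEq]
      exact ⟨by omega, add_comm _ _⟩
  · rintro ⟨⟨w', u⟩, ⟨h1, h2, h3⟩, heq⟩
    simp only [Prod.mk.injEq] at heq h1 h2 h3
    obtain ⟨rfl, rfl⟩ := heq
    have hp : (w' + 1, u + stair j) ∈ Pr (r + tri (j + 1)) (k + j) := by
      refine ⟨?_, ?_, ?_⟩
      · intro x hx
        rcases Multiset.mem_add.1 hx with hx | hx
        · exact h1 x hx
        · simp only [stair, Multiset.mem_map] at hx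
          obtain ⟨i, _, rfl⟩ := hx
          omega
      · simp only [Multiset.card_add]; omega
      · simp only [Multiset.sum_add]; omega
    refine ⟨hp, ?_⟩
    rw [lt_pmex_iff _ hp]
    exact ⟨Nat.succ_pos _, Multiset.le_add_left _ _⟩

theorem EE_add (j n k : ℕ) :
    (EE j n k).ncard + (EE (j + 1) n k).ncard = (DD (j + 1) n k).ncard := by
  have hf : ∀ i, (EE i n k).Finite := fun i => (Pr_finite n k).subset (fun p hp => hp.1)
  rw [← Set.ncard_union_eq _ (hf _) (hf _)]
  · congr 1
    ext p
    simp only [EE, DD, Set.mem_union, Set.mem_setOf_eq, Nat.even_iff]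
    constructor
    · rintro (⟨h1, h2, h3⟩ | ⟨h1, h2, h3⟩)
      · exact ⟨h1, by omega⟩
      · exact ⟨h1, by omega⟩
    · rintro ⟨h1, h2⟩
      by_cases h : (pmex p + j) % 2 = 0
      · exact Or.inl ⟨h1, by omega, h⟩
      · exact Or.inr ⟨h1, by omega, by omega⟩
  · rw [Set.disjoint_left]
    rintro p ⟨_, _, h⟩ ⟨_, _, h'⟩
    rw [Nat.even_iff] at h h'
    omega

theorem EE_lt {j n k : ℕ} {p : ℕ × Multiset ℕ} (hp : p ∈ EE j n k) :
    0 < p.1 ∧ stair j ≤ p.2 := by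
  obtain ⟨h1, h2, h3⟩ := hp
  rw [Nat.even_iff] at h3
  exact (lt_pmex_iff p h1 j).1 (by omega)

theorem main_eq (k : ℕ) : ∀ j n, (EE j (n + tri j) (k + j)).ncard = (CC j n k).ncard := by
  induction k with
  | zero =>
    intro j n
    by_cases hn : n ≤ j
    · have e1 : EE j (n + tri j) (0 + j) = ∅ := by
        rw [Set.eq_empty_iff_forall_notMem]
        intro p hp
        have h := EE_lt hp
        have h3 := hp.1.2.2
        obtain ⟨u, hu⟩ := Multiset.le_iff_exists_add.1 h.2
        have := stair_sum j
        rw [hu, Multiset.sum_add] at h3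
        rw [tri] at this
        omega
      have e2 : CC j n 0 = ∅ := by
        rw [Set.eq_empty_iff_forall_notMem]
        rintro p ⟨⟨_, _, h3⟩, h4⟩
        omega
      rw [e1, e2]
    · obtain ⟨r, rfl⟩ : ∃ r, n = r + j + 1 := ⟨n - j - 1, by omega⟩
      have a := EE_add j (r + tri (j + 1)) (0 + j)
      rw [DD_card, ← CC_add_FF j] at a
      have e1 : EE (j + 1) (r + tri (j + 1)) (0 + j) = ∅ := by
        rw [Set.eq_empty_iff_forall_notMem]
        intro p hp
        have h := Multiset.card_le_card (EE_lt hp).2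
        rw [stair_card, hp.1.2.1] at h
        omega
      have e2 : FF (j + 1) r 0 = ∅ := by
        rw [Set.eq_empty_iff_forall_notMem]
        rintro p ⟨⟨_, h2, _⟩, h4⟩
        have := Multiset.card_le_card (Multiset.filter_le (fun x => p.1 + (j + 1) < x) p.2)
        omega
      rw [e1, e2, Set.ncard_empty] at a
      rw [show r + j + 1 + tri j = r + tri (j + 1) by rw [tri]; omega]
      omega
  | succ k ih =>
    intro j n
    by_cases hn : n ≤ j
    · have e1 : EE j (n + tri j) (k + 1 + j) = ∅ := by
        rw [Set.eq_empty_iff_forall_notMem]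
        intro p hp
        have h := EE_lt hp
        have h3 := hp.1.2.2
        obtain ⟨u, hu⟩ := Multiset.le_iff_exists_add.1 h.2
        have := stair_sum j
        rw [hu, Multiset.sum_add] at h3
        rw [tri] at this
        omega
      have e2 : CC j n (k + 1) = ∅ := by
        rw [Set.eq_empty_iff_forall_notMem]
        rintro p ⟨⟨_, _, h3⟩, h4⟩
        omega
      rw [e1, e2]
    · obtain ⟨r, rfl⟩ : ∃ r, n = r + j + 1 := ⟨n - j - 1, by omega⟩
      have a := EE_add j (r + tri (j + 1)) (k + 1 + j)
      rw [DD_card, ← CC_add_FF j] at a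
      have b := ih (j + 1) r
      rw [← TT_CC _ _ _ (Or.inl (by omega)), TT_FF] at b
      rw [show k + (j + 1) = k + 1 + j by omega] at b
      rw [show r + j + 1 + tri j = r + tri (j + 1) by rw [tri]; omega]
      omega

theorem even_mex_eq_pos_crank (n k : ℕ) (hn : 2 ≤ n) :
    {p : Nat.Partition n | Even (mex p) ∧ betaStat p = k}.ncard = {p : Nat.Partition n | 0 < crank p ∧ betaStat p = k + 1}.ncard := by
  rw [even_count, crank_count, ← TT_FF, TT_CC _ _ _ (Or.inr hn)]
  exact main_eq k 0 n
end

section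
/- For every positive integer n, the number of partitions of n with even mex equals the number of partitions of n with negative crank. -/
open scoped Classical

/-- number of parts greater than `c` -/
def gtc (s : Multiset ℕ) (c : ℕ) : ℕ := s.countP (fun x => c < x)

/-- multisets of positive integers with sum `n` and property `Q` -/
def PS (n : ℕ) (Q : Multiset ℕ → Prop) : Set (Multiset ℕ) :=
  {s | (∀ x ∈ s, 0 < x) ∧ s.sum = n ∧ Q s}

/-- generalized fixed point -/
def FixAt (j c : ℕ) (s : Multiset ℕ) : Prop := gtc s c + j < c ∧ c ≤ j + gtc s (c - 1)

def FixP (j : ℕ) (s : Multiset ℕ) : Prop := ∃ c, FixAt j c s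

def GapP (j : ℕ) (s : Multiset ℕ) : Prop := ∃ c, c = j + gtc s c

def RunP (j r : ℕ) (s : Multiset ℕ) : Prop :=
  (∀ x, j < x → x ≤ j + r → x ∈ s) ∧ j + r + 1 ∉ s

def GP (j : ℕ) (s : Multiset ℕ) : Prop := ∃ r, Odd r ∧ RunP j r s

def NegC (s : Multiset ℕ) : Prop := gtc s (s.count 1) < s.count 1

lemma ncard_partition (n : ℕ) (Q : Multiset ℕ → Prop) :
    {p : Nat.Partition n | Q p.parts}.ncard = (PS n Q).ncard := by
  rw [← Set.ncard_image_of_injective _ (f := Nat.Partition.parts)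
    (fun a b h => Nat.Partition.ext h)]
  congr 1
  ext s
  constructor
  · rintro ⟨p, hp, rfl⟩
    exact ⟨fun x hx => p.parts_pos hx, p.parts_sum, hp⟩
  · rintro ⟨h1, h2, h3⟩
    exact ⟨⟨s, fun {i} hi => h1 i hi, h2⟩, h3, rfl⟩

lemma PS_finite (n : ℕ) (Q : Multiset ℕ → Prop) : (PS n Q).Finite := by
  apply Set.Finite.subset (Set.finite_range (Nat.Partition.parts (n := n)))
  rintro s ⟨h1, h2, h3⟩
  exact ⟨⟨s, fun {i} hi => h1 i hi, h2⟩, rfl⟩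

lemma PS_split (n : ℕ) (Q : Multiset ℕ → Prop) :
    (PS n Q).ncard + (PS n (fun s => ¬ Q s)).ncard = (PS n (fun _ => True)).ncard := by
  rw [← Set.ncard_union_eq _ (PS_finite _ _) (PS_finite _ _)]
  · congr 1
    ext s
    simp only [PS, Set.mem_union, Set.mem_ofPred_eq]
    tauto
  · rw [Set.disjoint_left]
    rintro s ⟨_, _, h⟩ ⟨_, _, h'⟩
    exact h' h

lemma gtc_anti (s : Multiset ℕ) {a b : ℕ} (h : a ≤ b) : gtc s b ≤ gtc s a := by
  induction s using Multiset.induction with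
  | empty => simp [gtc]
  | cons x s ih =>
    simp only [gtc, Multiset.countP_cons] at ih ⊢
    split_ifs <;> omega

lemma gtc_cons (s : Multiset ℕ) (a c : ℕ) :
    gtc (a ::ₘ s) c = gtc s c + if c < a then 1 else 0 := by
  simp [gtc, Multiset.countP_cons]

lemma gtc_add (s t : Multiset ℕ) (c : ℕ) : gtc (s + t) c = gtc s c + gtc t c := by
  simp [gtc]

lemma gtc_replicate (a k c : ℕ) :
    gtc (Multiset.replicate k a) c = if c < a then k else 0 := by
  induction k with
  | zero => simp [gtc]
  | succ k ih => rw [Multiset.replicate_succ, gtc_cons, ih]; split_ifs <;> simp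

lemma gtc_count (s : Multiset ℕ) (c : ℕ) : gtc s c = gtc s (c + 1) + s.count (c + 1) := by
  induction s using Multiset.induction with
  | empty => simp [gtc]
  | cons a s ih =>
    rw [gtc_cons, gtc_cons, Multiset.count_cons, ih]
    split_ifs <;> omega

lemma gtc_ext {s t : Multiset ℕ} (hs : ∀ x ∈ s, 0 < x) (ht : ∀ x ∈ t, 0 < x)
    (h : ∀ c, gtc s c = gtc t c) : s = t := by
  ext x
  cases x with
  | zero =>
    rw [Multiset.count_eq_zero_of_notMem, Multiset.count_eq_zero_of_notMem]
    · intro h0; exact absurd (ht 0 h0) (lt_irrefl _)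
    · intro h0; exact absurd (hs 0 h0) (lt_irrefl _)
  | succ x =>
    have h1 := gtc_count s x
    have h2 := gtc_count t x
    rw [h x, h (x+1)] at h1
    omega

lemma gtc_exists (N : ℕ) : ∀ f : ℕ → ℕ, (∀ x, f (x + 1) ≤ f x) → (∀ x, N ≤ x → f x = 0) →
    ∃ s : Multiset ℕ, (∀ x ∈ s, 0 < x) ∧ ∀ c, gtc s c = f c := by
  induction N with
  | zero =>
    intro f _ h0
    exact ⟨0, by simp, fun c => by simp [gtc, h0 c]⟩
  | succ N ih =>
    intro f hf h0
    have hanti : Antitone f := antitone_nat_of_succ_le hf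
    obtain ⟨t, ht, htc⟩ := ih (fun x => f x - f N) (fun x => by have := hf x; omega)
      (fun x hx => by have := hanti hx; omega)
    refine ⟨t + Multiset.replicate (f N) (N + 1), ?_, ?_⟩
    · intro x hx
      rcases Multiset.mem_add.1 hx with h | h
      · exact ht x h
      · rw [Multiset.eq_of_mem_replicate h]; omega
    · intro c
      rw [gtc_add, gtc_replicate, htc]
      split_ifs with h
      · have := hanti (show c ≤ N by omega); omega
      · have := h0 c (by omega); omega

lemma gtc_zero_of_large (s : Multiset ℕ) {c : ℕ} (h : s.sum ≤ c) : gtc s c = 0 := by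
  unfold gtc
  rw [Multiset.countP_eq_zero]
  intro a ha
  have := Multiset.le_sum_of_mem ha
  omega

/-- insertion map -/
def ins (c : ℕ) (s : Multiset ℕ) : Multiset ℕ :=
  c ::ₘ s.map (fun x => if c < x then x - 1 else x)

lemma ins_sum (c : ℕ) (s : Multiset ℕ) : (ins c s).sum + gtc s c = s.sum + c := by
  induction s using Multiset.induction with
  | empty => simp [ins, gtc]
  | cons a s ih =>
    simp only [ins, Multiset.map_cons, Multiset.sum_cons, gtc_cons] at ih ⊢
    split_ifs <;> omega

lemma ins_gtc (c : ℕ) (s : Multiset ℕ) (x : ℕ) :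
    gtc (ins c s) x = if x < c then gtc s x + 1 else gtc s (x + 1) := by
  induction s using Multiset.induction with
  | empty =>
    simp only [ins, Multiset.map_zero, gtc_cons]
    simp [gtc]
  | cons a s ih =>
    simp only [ins, Multiset.map_cons, gtc_cons] at ih ⊢
    split_ifs at ih ⊢ <;> omega

lemma ins_pos {c : ℕ} (hc : 0 < c) {s : Multiset ℕ} (hs : ∀ x ∈ s, 0 < x) :
    ∀ x ∈ ins c s, 0 < x := by
  intro x hx
  rcases Multiset.mem_cons.1 hx with h | h
  · omega
  · obtain ⟨y, hy, rfl⟩ := Multiset.mem_map.1 h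
    have := hs y hy
    split_ifs <;> omega

lemma fix_unique {j c d : ℕ} {s : Multiset ℕ} (h1 : FixAt j c s) (h2 : FixAt j d s) : c = d := by
  obtain ⟨a1, a2⟩ := h1
  obtain ⟨b1, b2⟩ := h2
  by_contra hne
  rcases Nat.lt_or_gt_of_ne hne with h | h
  · have := gtc_anti s (show c ≤ d - 1 by omega); omega
  · have := gtc_anti s (show d ≤ c - 1 by omega); omega

lemma gap_iff (j : ℕ) (s : Multiset ℕ) : GapP j s ↔ ¬ FixP j s := by
  constructor
  · rintro ⟨c, hc⟩ ⟨d, h1, h2⟩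
    rcases Nat.lt_trichotomy c d with h | h | h
    · have := gtc_anti s (show c ≤ d - 1 by omega); omega
    · subst h; omega
    · have := gtc_anti s (show d ≤ c by omega); omega
  · intro h
    have hex : ∃ c, gtc s c + j ≤ c := ⟨s.sum + j, by rw [gtc_zero_of_large] <;> omega⟩
    refine ⟨Nat.find hex, ?_⟩
    have h1 := Nat.find_spec hex
    by_contra hne
    apply h
    refine ⟨Nat.find hex, by omega, ?_⟩
    have h2 := Nat.find_min hex (m := Nat.find hex - 1) (by omega)
    omega

lemma fix_step (n j : ℕ) :
    (PS n (GapP (j + 1))).ncard = (PS (n + j + 1) (FixP j)).ncard := by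
  have key : ∀ s, (hs : GapP (j + 1) s) → FixAt j hs.choose (ins hs.choose s) := by
    intro s hs
    have h := hs.choose_spec
    set c := hs.choose
    refine ⟨?_, ?_⟩
    · rw [ins_gtc, if_neg (lt_irrefl _)]
      have := gtc_anti s (show c ≤ c + 1 by omega); omega
    · rw [ins_gtc, if_pos (by omega)]
      have := gtc_anti s (show c - 1 ≤ c by omega); omega
  apply Set.ncard_congr (fun s hs => ins hs.2.2.choose s)
  · rintro s ⟨h1, h2, h3⟩
    have h := h3.choose_spec
    refine ⟨ins_pos (by omega) h1, ?_, _, key s h3⟩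
    have := ins_sum h3.choose s
    omega
  · rintro s t ⟨hs1, hs2, hs3⟩ ⟨ht1, ht2, ht3⟩ heq
    have k1 := key s hs3
    have k2 := key t ht3
    have e1 := hs3.choose_spec
    have e2 := ht3.choose_spec
    beta_reduce at heq
    rw [heq] at k1
    have hc := fix_unique k1 k2
    rw [← hc] at heq e2
    set c := hs3.choose
    apply gtc_ext hs1 ht1
    intro x
    have hx := congrArg (fun m => gtc m x) heq
    have hx1 := congrArg (fun m => gtc m (x - 1)) heq
    simp only [ins_gtc] at hx hx1
    rcases Nat.lt_trichotomy x c with h | h | h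
    · simpa [h] using hx
    · subst h; omega
    · rw [if_neg (by omega), if_neg (by omega), Nat.sub_add_cancel (by omega)] at hx1
      exact hx1
  · rintro r ⟨h1, h2, c, hc1, hc2⟩
    obtain ⟨s, hs, hsg⟩ := gtc_exists (r.sum + c + 1)
      (fun x => if x < c then gtc r x - 1 else if x = c then c - j - 1 else gtc r (x - 1))
      (by
        intro x
        have a1 := gtc_anti r (show x ≤ x + 1 by omega)
        have a2 := gtc_anti r (show x - 1 ≤ x by omega)
        simp only [Nat.add_sub_cancel]
        rcases Nat.lt_trichotomy (x + 1) c with h | h | h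
        · simp [h, show x < c by omega]; omega
        · subst h; simp at hc2 ⊢; omega
        · by_cases hx : x = c
          · subst hx; simp; omega
          · rw [if_neg (by omega), if_neg (by omega), if_neg (by omega), if_neg hx]; exact a2)
      (by
        intro x hx
        rw [if_neg (by omega), if_neg (by omega)]
        exact gtc_zero_of_large _ (by omega))
    have hg : c = j + 1 + gtc s c := by rw [hsg]; simp; omega
    have hgap : GapP (j + 1) s := ⟨c, hg⟩
    have hins : ins c s = r := by
      apply gtc_ext (ins_pos (by omega) hs) h1
      intro x
      rw [ins_gtc, hsg, hsg]
      split_ifs with h h' h''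
      · have := gtc_anti r (show x ≤ c - 1 by omega); omega
      · omega
      · omega
      · simp
    have hsum := ins_sum c s
    rw [hins] at hsum
    refine ⟨s, ⟨hs, by omega, hgap⟩, ?_⟩
    have hcc : hgap.choose = c := by
      have e := hgap.choose_spec
      rcases Nat.lt_trichotomy hgap.choose c with h | h | h
      · have := gtc_anti s h.le; omega
      · exact h
      · have := gtc_anti s h.le; omega
    simp only [hcc, hins]

lemma fix_small (n j : ℕ) (h : n < j + 1) : PS n (FixP j) = ∅ := by
  rw [Set.eq_empty_iff_forall_notMem]
  rintro s ⟨h1, h2, c, hc1, hc2⟩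
  rw [gtc_zero_of_large s (c := c - 1) (by omega)] at hc2
  omega

lemma run_unique {j r r' : ℕ} {s : Multiset ℕ} (h : RunP j r s) (h' : RunP j r' s) : r = r' := by
  by_contra hne
  rcases Nat.lt_or_gt_of_ne hne with hl | hl
  · exact h.2 (h'.1 _ (by omega) (by omega))
  · exact h'.2 (h.1 _ (by omega) (by omega))

lemma run_exists (j : ℕ) (s : Multiset ℕ) : ∃ r, RunP j r s := by
  have hex : ∃ r, j + r + 1 ∉ s := ⟨s.sum, fun h => by
    have := Multiset.le_sum_of_mem h; omega⟩
  refine ⟨Nat.find hex, ?_, Nat.find_spec hex⟩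
  intro x h1 h2
  have := Nat.find_min hex (m := x - j - 1) (by omega)
  rw [not_not] at this
  rwa [show j + (x - j - 1) + 1 = x by omega] at this

lemma not_GP_iff (j : ℕ) (s : Multiset ℕ) : ¬ GP j s ↔ ∃ r, Even r ∧ RunP j r s := by
  obtain ⟨r, hr⟩ := run_exists j s
  constructor
  · intro h
    refine ⟨r, ?_, hr⟩
    by_contra h'
    exact h ⟨r, Nat.not_even_iff_odd.1 h', hr⟩
  · rintro ⟨r, he, h1⟩ ⟨r', ho, h2⟩
    rw [run_unique h1 h2] at he
    exact (Nat.not_even_iff_odd.2 ho) he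

lemma run_cons (j r : ℕ) (t : Multiset ℕ) :
    RunP j (r + 1) ((j + 1) ::ₘ t) ↔ RunP (j + 1) r t := by
  unfold RunP
  constructor
  · rintro ⟨h1, h2⟩
    constructor
    · intro x hx hx'
      rcases Multiset.mem_cons.1 (h1 x (by omega) (by omega)) with h | h
      · omega
      · exact h
    · intro h
      apply h2
      rw [show j + (r + 1) + 1 = j + 1 + r + 1 by omega]
      exact Multiset.mem_cons_of_mem h
  · rintro ⟨h1, h2⟩
    constructor
    · intro x hx hx'
      by_cases h : x = j + 1
      · subst h; exact Multiset.mem_cons_self _ _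
      · exact Multiset.mem_cons_of_mem (h1 x (by omega) (by omega))
    · intro h
      rcases Multiset.mem_cons.1 h with h | h
      · omega
      · apply h2
        rwa [show j + 1 + r + 1 = j + (r + 1) + 1 by omega]

lemma GP_step (n j : ℕ) :
    (PS n (fun s => ¬ GP (j + 1) s)).ncard = (PS (n + j + 1) (GP j)).ncard := by
  apply Set.ncard_congr (fun s _ => (j + 1) ::ₘ s)
  · rintro s ⟨h1, h2, h3⟩
    obtain ⟨r, hr, hr'⟩ := (not_GP_iff _ _).1 h3
    refine ⟨?_, ?_, r + 1, hr.add_one, (run_cons _ _ _).2 hr'⟩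
    · intro x hx
      rcases Multiset.mem_cons.1 hx with h | h
      · omega
      · exact h1 x h
    · rw [Multiset.sum_cons]; omega
  · intro s t _ _ h
    exact (Multiset.cons_inj_right _).1 h
  · rintro s ⟨h1, h2, r, hr, hr'⟩
    obtain ⟨q, rfl⟩ : ∃ q, r = q + 1 := ⟨r - 1, by have := hr.pos; omega⟩
    have hm : j + 1 ∈ s := hr'.1 _ (by omega) (by omega)
    obtain ⟨t, rfl⟩ := Multiset.exists_cons_of_mem hm
    refine ⟨t, ⟨fun x hx => h1 x (Multiset.mem_cons_of_mem hx), ?_, ?_⟩, rfl⟩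
    · rw [Multiset.sum_cons] at h2; omega
    · beta_reduce
      rw [not_GP_iff]
      refine ⟨q, ?_, (run_cons _ _ _).1 hr'⟩
      rw [Nat.odd_add_one] at hr
      exact Nat.not_odd_iff_even.1 hr

lemma GP_small (n j : ℕ) (h : n < j + 1) : PS n (GP j) = ∅ := by
  rw [Set.eq_empty_iff_forall_notMem]
  rintro s ⟨h1, h2, r, hr, hr'⟩
  have := hr.pos
  have := Multiset.le_sum_of_mem (hr'.1 (j + 1) (by omega) (by omega))
  omega

lemma GP_eq_fix (n : ℕ) : ∀ j, (PS n (GP j)).ncard = (PS n (FixP j)).ncard := by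
  induction n using Nat.strong_induction_on with
  | _ n ih =>
    intro j
    by_cases h : n < j + 1
    · rw [GP_small n j h, fix_small n j h]
    · obtain ⟨m, rfl⟩ : ∃ m, n = m + j + 1 := ⟨n - j - 1, by omega⟩
      rw [← GP_step, ← fix_step]
      have h1 := PS_split m (GP (j + 1))
      have h2 := PS_split m (FixP (j + 1))
      have h3 := ih m (by omega) (j + 1)
      have h4 : PS m (GapP (j + 1)) = PS m (fun s => ¬ FixP (j + 1) s) := by
        unfold PS; simp only [gap_iff]
      rw [h4]
      omega

lemma fix_mem {c : ℕ} {s : Multiset ℕ} (h : FixAt 0 c s) : c ∈ s := by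
  obtain ⟨h1, h2⟩ := h
  have := gtc_count s (c - 1)
  rw [Nat.sub_add_cancel (by omega)] at this
  rw [← Multiset.one_le_count_iff_mem]
  omega

lemma fix_crank (n : ℕ) : (PS n (FixP 0)).ncard = (PS n NegC).ncard := by
  have hadd : ∀ (t : Multiset ℕ) (d c : ℕ), 0 < c →
      gtc (t + Multiset.replicate d 1) c = gtc t c := by
    intro t d c hc
    rw [gtc_add, gtc_replicate, if_neg (by omega), add_zero]
  apply Set.ncard_congr (fun s hs => s.erase hs.2.2.choose + Multiset.replicate hs.2.2.choose 1)
  · rintro s ⟨h1, h2, h3⟩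
    have hc := h3.choose_spec
    beta_reduce
    generalize h3.choose = c at hc ⊢
    obtain ⟨t, rfl⟩ := Multiset.exists_cons_of_mem (fix_mem hc)
    rw [Multiset.erase_cons_head]
    obtain ⟨hc1, hc2⟩ := hc
    refine ⟨?_, ?_, ?_⟩
    · intro x hx
      rcases Multiset.mem_add.1 hx with h | h
      · exact h1 x (Multiset.mem_cons_of_mem h)
      · rw [Multiset.eq_of_mem_replicate h]; omega
    · simp at h2 ⊢; omega
    · unfold NegC
      rw [Multiset.count_add, Multiset.count_replicate_self, hadd _ _ _ (by omega)]
      have := gtc_anti t (show c ≤ t.count 1 + c by omega)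
      rw [gtc_cons] at hc1
      omega
  · rintro s t ⟨hs1, hs2, hs3⟩ ⟨ht1, ht2, ht3⟩ heq
    have k1 := hs3.choose_spec
    have k2 := ht3.choose_spec
    beta_reduce at heq
    generalize hs3.choose = c at k1 heq
    generalize ht3.choose = d at k2 heq
    obtain ⟨s, rfl⟩ := Multiset.exists_cons_of_mem (fix_mem k1)
    obtain ⟨t, rfl⟩ := Multiset.exists_cons_of_mem (fix_mem k2)
    rw [Multiset.erase_cons_head, Multiset.erase_cons_head] at heq
    have hg : ∀ x, 0 < x → gtc s x = gtc t x := by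
      intro x hx
      rw [← hadd s c x hx, ← hadd t d x hx, heq]
    obtain ⟨a1, a2⟩ := k1
    obtain ⟨b1, b2⟩ := k2
    rw [gtc_cons] at a1 a2 b1 b2
    have hcd : c = d := by
      by_contra hne
      rcases Nat.lt_or_gt_of_ne hne with h | h
      · have := gtc_anti s (show c ≤ d - 1 by omega)
        have := hg (d - 1) (by omega)
        split_ifs at * <;> omega
      · have := gtc_anti t (show d ≤ c - 1 by omega)
        have := hg (c - 1) (by omega)
        split_ifs at * <;> omega
    rw [hcd] at heq ⊢
    rw [add_right_cancel heq]
  · rintro r ⟨h1, h2, h3⟩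
    unfold NegC at h3
    have hex : ∃ c, gtc r c < c := ⟨_, h3⟩
    have m1 := Nat.find_spec hex
    have m2 := Nat.find_min' hex h3
    have m3 := Nat.find_min hex (m := Nat.find hex - 1)
    set c := Nat.find hex
    obtain ⟨t, ht⟩ : ∃ t, r = t + Multiset.replicate c 1 := by
      have := Multiset.le_count_iff_replicate_le.1 m2
      obtain ⟨t, ht⟩ := Multiset.le_iff_exists_add.1 this
      exact ⟨t, by rw [ht, add_comm]⟩
    clear_value c
    subst ht
    have hfix : FixAt 0 c (c ::ₘ t) := by
      refine ⟨?_, ?_⟩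
      · rw [gtc_cons, if_neg (lt_irrefl _), ← hadd t c c (by omega)]; omega
      · rw [gtc_cons, if_pos (by omega)]
        by_cases h : c = 1
        · omega
        · have := m3 (by omega)
          rw [hadd _ _ _ (by omega)] at this
          omega
    have hF : FixP 0 (c ::ₘ t) := ⟨c, hfix⟩
    refine ⟨c ::ₘ t, ⟨?_, ?_, hF⟩, ?_⟩
    · intro x hx
      rcases Multiset.mem_cons.1 hx with h | h
      · omega
      · exact h1 x (Multiset.mem_add.2 (Or.inl h))
    · simp at h2 ⊢; omega
    · have : hF.choose = c := fix_unique hF.choose_spec hfix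
      simp only [this, Multiset.erase_cons_head]

lemma mex_iff {n : ℕ} (p : n.Partition) : Even (mex p) ↔ GP 0 p.parts := by
  obtain ⟨r, hr⟩ := run_exists 0 p.parts
  have hm : mex p = r + 1 := by
    have hmem : r + 1 ∈ {m : ℕ | 0 < m ∧ m ∉ p.parts} := by
      refine ⟨by omega, ?_⟩
      have := hr.2
      rwa [zero_add] at this
    apply le_antisymm
    · exact Nat.sInf_le hmem
    · have h := Nat.sInf_mem ⟨_, hmem⟩
      by_contra hlt
      unfold mex at hlt
      exact h.2 (hr.1 _ h.1 (by omega))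
  rw [hm, Nat.even_add_one, Nat.not_even_iff_odd]
  constructor
  · intro h; exact ⟨r, h, hr⟩
  · rintro ⟨q, hq, hq'⟩
    rwa [run_unique hr hq']

lemma crank_iff_s14 {n : ℕ} (p : n.Partition) : crank p < 0 ↔ NegC p.parts := by
  have hmu : muStat p = gtc p.parts (omegaStat p) := by
    unfold muStat gtc
    rw [Multiset.countP_eq_card_filter]
  unfold crank NegC
  split_ifs with h
  · unfold omegaStat at h
    rw [h]
    constructor
    · intro h'; omega
    · intro h'; omega
  · rw [hmu]
    unfold omegaStat
    omega

theorem even_mex_eq_neg_crank_total (n : ℕ) (hn : 0 < n) :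
    {p : Nat.Partition n | Even (mex p)}.ncard = {p : Nat.Partition n | crank p < 0}.ncard := by
  simp only [mex_iff, crank_iff_s14]
  rw [ncard_partition n (GP 0), ncard_partition n NegC, GP_eq_fix, fix_crank]
end
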